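/- Let F be a field and let Ω be a connected, eventually outward, finitely branching tree quiver. If V is a FLEI representation of Ω over F and W is a subrepresentation of V, then both W and the quotient representation V/W are FLEI. -/

import Mathlib

/-- A quiver: a set of vertices, a set of arrows, with source and target maps. -/
structure Quiv : Type 1 where
  V : Type
  A : Type
  s : A → V
  t : A → V

/-- A representation of a quiver over a field `F`. -/
structure QRep (F : Type) [Field F] (Q : Quiv) : Type 1 where
  M : Q.V → Type
  [acg : ∀ i, AddCommGroup (M i)]
  [mod : ∀ i, Module F (M i)]
  map : ∀ a : Q.A, M (Q.s a) →ₗ[F] M (Q.t a)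

attribute [instance] QRep.acg QRep.mod

namespace QRep

variable {F : Type} [Field F] {Q : Quiv}

/-- A representation is nonzero if some vertex space has a nonzero vector. -/
def Nonzero (V : QRep F Q) : Prop := ∃ i, ∃ x : V.M i, x ≠ 0

/-- A morphism of representations. -/
structure Hom (V W : QRep F Q) : Type where
  app : ∀ i, V.M i →ₗ[F] W.M i
  comm : ∀ a : Q.A, (W.map a).comp (app (Q.s a)) = (app (Q.t a)).comp (V.map a)

/-- A morphism is an isomorphism iff it is bijective at each vertex. -/
def Hom.IsIso {V W : QRep F Q} (f : Hom V W) : Prop := ∀ i, Function.Bijective (f.app i)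

/-- Two representations are isomorphic. -/
def Iso (V W : QRep F Q) : Prop := ∃ f : Hom V W, f.IsIso

/-- The (external) direct sum of two representations. -/
def dsum (V W : QRep F Q) : QRep F Q where
  M i := V.M i × W.M i
  map a := (V.map a).prodMap (W.map a)

/-- A representation is indecomposable if it is nonzero and not isomorphic to a direct
sum of two nonzero representations. -/
def Indec (V : QRep F Q) : Prop :=
  V.Nonzero ∧ ∀ A B : QRep F Q, A.Nonzero → B.Nonzero → ¬ Iso V (dsum A B)

/-- FLEI: locally finite-dimensional, and all but finitely many arrow maps are
isomorphisms. -/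
def IsFLEI (V : QRep F Q) : Prop :=
  (∀ i, FiniteDimensional F (V.M i)) ∧ {a : Q.A | ¬ Function.Bijective (V.map a)}.Finite

end QRep

/-- A subrepresentation: a subspace at each vertex, stable under the arrow maps. -/
structure Subrep {F : Type} [Field F] {Q : Quiv} (V : QRep F Q) : Type where
  S : ∀ i, Submodule F (V.M i)
  stable : ∀ a : Q.A, ∀ x ∈ S (Q.s a), V.map a x ∈ S (Q.t a)

namespace Subrep

variable {F : Type} [Field F] {Q : Quiv} {V : QRep F Q}

/-- A subrepresentation, viewed as a representation in its own right. -/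
def toRep (W : Subrep V) : QRep F Q where
  M i := ↥(W.S i)
  map a := (V.map a).restrict (W.stable a)

/-- The quotient of a representation by a subrepresentation. -/
def quot (W : Subrep V) : QRep F Q where
  M i := V.M i ⧸ W.S i
  map a := Submodule.mapQ _ _ (V.map a) (fun x hx => W.stable a x hx)

end Subrep
/-- Adjacency in the underlying graph of a quiver. -/
def Quiv.Adj (Q : Quiv) (i j : Q.V) : Prop :=
  ∃ a : Q.A, (Q.s a = i ∧ Q.t a = j) ∨ (Q.s a = j ∧ Q.t a = i)

/-- The underlying graph is connected. -/
def Quiv.Connected (Q : Quiv) : Prop :=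
  ∀ i j : Q.V, Relation.ReflTransGen Q.Adj i j

/-- Source of an oriented edge-traversal (arrow plus direction of traversal). -/
def Quiv.esrc (Q : Quiv) (p : Q.A × Bool) : Q.V := if p.2 then Q.s p.1 else Q.t p.1

/-- Target of an oriented edge-traversal. -/
def Quiv.etgt (Q : Quiv) (p : Q.A × Bool) : Q.V := if p.2 then Q.t p.1 else Q.s p.1

/-- `e 0, …, e (n-1)` is a cycle: a closed walk of positive length in the underlying
graph traversing no edge twice. -/
def Quiv.IsCycle (Q : Quiv) (n : ℕ) (e : ℕ → Q.A × Bool) : Prop :=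
  0 < n ∧ (∀ k < n, Q.etgt (e k) = Q.esrc (e ((k + 1) % n))) ∧
    (∀ j < n, ∀ k < n, (e j).1 = (e k).1 → j = k)

/-- The quiver has no cycles in its underlying graph. -/
def Quiv.NoCycles (Q : Quiv) : Prop := ¬ ∃ (n : ℕ) (e : ℕ → Q.A × Bool), Q.IsCycle n e

/-- A tree quiver: connected underlying graph with no cycles. -/
def Quiv.IsTree (Q : Quiv) : Prop := Q.Connected ∧ Q.NoCycles
/-- A journey in a quiver: a finite or infinite sequence of pairwise distinct vertices
`vert 0, vert 1, …` (up to index `len`, which may be `⊤`), consecutive vertices being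
joined by an arrow (in either direction). -/
structure Journey (Q : Quiv) : Type where
  len : ℕ∞
  vert : ℕ → Q.V
  edge : ∀ k : ℕ, (k : ℕ∞) < len → Q.A
  inj : ∀ m n : ℕ, (m : ℕ∞) ≤ len → (n : ℕ∞) ≤ len → vert m = vert n → m = n
  adj : ∀ (k : ℕ) (h : (k : ℕ∞) < len),
    (Q.s (edge k h) = vert k ∧ Q.t (edge k h) = vert (k + 1)) ∨
    (Q.s (edge k h) = vert (k + 1) ∧ Q.t (edge k h) = vert k)

/-- A quiver is eventually outward if every journey contains only finitely many arrows
pointing towards the start of the journey. -/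
def Quiv.EventuallyOutward (Q : Quiv) : Prop :=
  ∀ j : Journey Q,
    {k : ℕ | ∃ h : (k : ℕ∞) < j.len,
      Q.s (j.edge k h) = j.vert (k + 1) ∧ Q.t (j.edge k h) = j.vert k}.Finite

/-- A quiver is finitely branching if it is a union of finitely many journeys. -/
def Quiv.FinitelyBranching (Q : Quiv) : Prop :=
  ∃ (n : ℕ) (js : Fin n → Journey Q),
    (∀ v : Q.V, ∃ (m : Fin n) (k : ℕ), (k : ℕ∞) ≤ (js m).len ∧ (js m).vert k = v) ∧
    (∀ a : Q.A, ∃ (m : Fin n) (k : ℕ) (h : (k : ℕ∞) < (js m).len), (js m).edge k h = a)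

namespace Subrep

variable {F : Type} [Field F] {Q : Quiv} {V : QRep F Q}

/-- The codimension of a subrepresentation at a vertex. -/
noncomputable def codim (W : Subrep V) (i : Q.V) : ℕ := Module.finrank F (V.M i ⧸ W.S i)

theorem quot_map_surjective (W : Subrep V) {a : Q.A} (ha : Function.Surjective (V.map a)) :
    Function.Surjective (W.quot.map a) := by
  intro y
  obtain ⟨y, rfl⟩ := Submodule.Quotient.mk_surjective _ y
  obtain ⟨x, rfl⟩ := ha y
  exact ⟨Submodule.Quotient.mk x, rfl⟩

theorem codim_target_le (W : Subrep V) {a : Q.A} [FiniteDimensional F (V.M (Q.s a))]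
    (ha : Function.Surjective (V.map a)) : W.codim (Q.t a) ≤ W.codim (Q.s a) :=
  have : FiniteDimensional F (W.quot.M (Q.s a)) :=
    inferInstanceAs (FiniteDimensional F (V.M (Q.s a) ⧸ W.S (Q.s a)))
  LinearMap.finrank_le_finrank_of_surjective (f := W.quot.map a) (W.quot_map_surjective ha)

theorem quot_map_bijective (W : Subrep V) {a : Q.A} [FiniteDimensional F (V.M (Q.s a))]
    [FiniteDimensional F (V.M (Q.t a))] (ha : Function.Surjective (V.map a))
    (h : W.codim (Q.s a) = W.codim (Q.t a)) : Function.Bijective (W.quot.map a) := by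
  have : FiniteDimensional F (W.quot.M (Q.s a)) :=
    inferInstanceAs (FiniteDimensional F (V.M (Q.s a) ⧸ W.S (Q.s a)))
  have : FiniteDimensional F (W.quot.M (Q.t a)) :=
    inferInstanceAs (FiniteDimensional F (V.M (Q.t a) ⧸ W.S (Q.t a)))
  have hs := W.quot_map_surjective ha
  exact ⟨(LinearMap.injective_iff_surjective_of_finrank_eq_finrank h).2 hs, hs⟩

theorem toRep_map_bijective (W : Subrep V) {a : Q.A} (ha : Function.Bijective (V.map a))
    (h : Function.Injective (W.quot.map a)) : Function.Bijective (W.toRep.map a) := by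
  constructor
  · intro x y hxy
    exact Subtype.ext (ha.1 (congrArg Subtype.val hxy))
  · rintro ⟨y, hy⟩
    obtain ⟨x, rfl⟩ := ha.2 y
    have hx : x ∈ W.S (Q.s a) := by
      rw [← Submodule.Quotient.mk_eq_zero]
      have h0 : V.map a x ∈ W.S (Q.t a) →
          (Submodule.Quotient.mk (V.map a x) : W.quot.M (Q.t a)) = 0 :=
        (Submodule.Quotient.mk_eq_zero (W.S (Q.t a))).2
      exact h ((h0 hy).trans (map_zero (W.quot.map a)).symm)
    exact ⟨⟨x, hx⟩, rfl⟩

end Subrep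

namespace Journey

variable {Q : Quiv}

theorem edge_inj (j : Journey Q) {k l : ℕ} (hk : (k : ℕ∞) < j.len) (hl : (l : ℕ∞) < j.len)
    (h : j.edge k hk = j.edge l hl) : k = l := by
  have hk' : ((k + 1 : ℕ) : ℕ∞) ≤ j.len := by exact_mod_cast Order.add_one_le_of_lt hk
  have hl' : ((l + 1 : ℕ) : ℕ∞) ≤ j.len := by exact_mod_cast Order.add_one_le_of_lt hl
  have h1 := j.adj k hk
  have h2 := j.adj l hl
  rw [h] at h1
  have key : j.vert k = j.vert l ∨ (j.vert k = j.vert (l + 1) ∧ j.vert (k + 1) = j.vert l) := by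
    grind
  rcases key with e | ⟨e, e'⟩
  · exact j.inj _ _ hk.le hl.le e
  · have := j.inj _ _ hk.le hl' e
    have := j.inj _ _ hk' hl.le e'
    omega

theorem finite_edge_mem (j : Journey Q) {s : Set Q.A} (hs : s.Finite) :
    {k : ℕ | ∃ h : (k : ℕ∞) < j.len, j.edge k h ∈ s}.Finite := by
  have : Finite s := hs
  exact Finite.of_injective
    (fun k : {k : ℕ | ∃ h : (k : ℕ∞) < j.len, j.edge k h ∈ s} =>
      (⟨j.edge k.1 k.2.1, k.2.2⟩ : s))
    fun k l h => Subtype.ext (j.edge_inj k.2.1 l.2.1 (congrArg Subtype.val h))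

end Journey

/-- A sequence of naturals that is eventually antitone drops only finitely often. -/
theorem finite_setOf_succ_ne_of_eventually_antitone {f : ℕ → ℕ} {N : ℕ}
    (hf : ∀ k, N ≤ k → f (k + 1) ≤ f k) : {k | f k ≠ f (k + 1)}.Finite := by
  have ha : Antitone fun k => f (N + k) := antitone_nat_of_succ_le fun k => hf _ (Nat.le_add_right N k)
  obtain ⟨m, hm⟩ := WellFoundedLT.antitone_chain_condition ha
  refine (Set.finite_lt_nat (N + m)).subset fun k hk => ?_
  by_contra hlt
  simp only [Set.mem_ofPred_eq, not_lt] at hlt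
  obtain ⟨l, rfl⟩ := Nat.exists_eq_add_of_le hlt
  have h1 := hm (m + l) (by omega)
  have h2 := hm (m + l + 1) (by omega)
  apply hk
  rw [add_assoc N m l, add_assoc N (m + l) 1]
  exact h1.symm.trans h2

/-- Along a journey, only finitely many arrows fail to preserve the codimension of a
subrepresentation of an FLEI representation. -/
theorem Journey.finite_codim_ne {F : Type} [Field F] {Q : Quiv} (j : Journey Q)
    (hout : Q.EventuallyOutward) {V : QRep F Q} (hV : V.IsFLEI) (W : Subrep V) :
    {k : ℕ | ∃ h : (k : ℕ∞) < j.len,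
      W.codim (Q.s (j.edge k h)) ≠ W.codim (Q.t (j.edge k h))}.Finite := by
  have hfd := hV.1
  rcases eq_or_ne j.len ⊤ with hlen | hlen
  swap
  · obtain ⟨n, hlen⟩ := ENat.ne_top_iff_exists.1 hlen
    refine (Set.finite_lt_nat n).subset fun k hk => ?_
    obtain ⟨h, -⟩ := hk
    rw [← hlen] at h
    exact_mod_cast h
  · obtain ⟨N, hN⟩ := ((hout j).union (j.finite_edge_mem hV.2)).bddAbove
    have hlt (k : ℕ) : (k : ℕ∞) < j.len := hlen ▸ ENat.natCast_lt_top k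
    have key (k : ℕ) (hk : N + 1 ≤ k) : W.codim (j.vert (k + 1)) ≤ W.codim (j.vert k) := by
      rcases j.adj k (hlt k) with h | h
      · have hb : Function.Bijective (V.map (j.edge k (hlt k))) := by
          by_contra hb
          exact Nat.not_succ_le_self N (hk.trans (hN (Or.inr ⟨hlt k, hb⟩)))
        have := W.codim_target_le hb.2
        rwa [h.1, h.2] at this
      · exact absurd (hk.trans (hN (Or.inl ⟨hlt k, h⟩))) (Nat.not_succ_le_self N)
    refine (finite_setOf_succ_ne_of_eventually_antitone
      (f := fun k => W.codim (j.vert k)) key).subset ?_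
    rintro k ⟨h, hne⟩ heq
    rcases j.adj k h with e | e
    · exact hne (by rw [e.1, e.2, heq])
    · exact hne (by rw [e.1, e.2, heq])

theorem Subrep.finite_codim_ne {F : Type} [Field F] {Q : Quiv}
    (hout : Q.EventuallyOutward) (hfb : Q.FinitelyBranching)
    {V : QRep F Q} (hV : V.IsFLEI) (W : Subrep V) :
    {a : Q.A | W.codim (Q.s a) ≠ W.codim (Q.t a)}.Finite := by
  obtain ⟨n, js, -, hjs⟩ := hfb
  choose m k hk hedge using hjs
  have hfin : (⋃ i : Fin n, Prod.mk i '' {k : ℕ | ∃ h : (k : ℕ∞) < (js i).len,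
      W.codim (Q.s ((js i).edge k h)) ≠ W.codim (Q.t ((js i).edge k h))}).Finite :=
    Set.finite_iUnion fun i => ((js i).finite_codim_ne hout hV W).image _
  refine Set.Finite.of_finite_image (f := fun a => (m a, k a)) (hfin.subset ?_) ?_
  · rintro _ ⟨a, ha, rfl⟩
    refine Set.mem_iUnion.2 ⟨m a, k a, ⟨hk a, ?_⟩, rfl⟩
    rwa [hedge]
  · intro a _ b _ hab
    simp only [Prod.mk.injEq] at hab
    have ha := hedge a
    have hb := hedge b
    grind

/-- If `Ω` is a connected, eventually outward, finitely branching tree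
quiver, `V` is a FLEI representation of `Ω` and `W` is a subrepresentation of `V`, then
both `W` and the quotient `V/W` are FLEI. -/
theorem stmt0 (F : Type) [Field F] (Q : Quiv)
    (htree : Q.IsTree) (hout : Q.EventuallyOutward) (hfb : Q.FinitelyBranching)
    (V : QRep F Q) (hV : V.IsFLEI) (W : Subrep V) :
    W.toRep.IsFLEI ∧ W.quot.IsFLEI := by
  have hfd := hV.1
  have hfin := hV.2.union (W.finite_codim_ne hout hfb hV)
  have hbij (a : Q.A) (ha : a ∉ {a | ¬ Function.Bijective (V.map a)} ∪
      {a | W.codim (Q.s a) ≠ W.codim (Q.t a)}) :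
      Function.Bijective (W.toRep.map a) ∧ Function.Bijective (W.quot.map a) := by
    simp only [Set.mem_union, Set.mem_ofPred_eq, not_or, not_not] at ha
    have hq := W.quot_map_bijective ha.1.2 ha.2
    exact ⟨W.toRep_map_bijective ha.1 hq.1, hq⟩
  refine ⟨⟨fun i => ?_, hfin.subset fun a ha => ?_⟩, ⟨fun i => ?_, hfin.subset fun a ha => ?_⟩⟩
  · exact inferInstanceAs (FiniteDimensional F (W.S i))
  · by_contra h
    exact ha (hbij a h).1
  · exact inferInstanceAs (FiniteDimensional F (V.M i ⧸ W.S i))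
  · by_contra h
    exact ha (hbij a h).2
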